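/- Suppose the linear operators 𝒜₁,…,𝒜ₛ : ℝ^{n×n} → ℝ^m satisfy the ARIP at rank 2r with parameter δ₂ᵣ and at rank 3r with parameter δ₃ᵣ, where δ₂ᵣ ≤ δ₃ᵣ < 1. Let X₁,…,Xₛ ∈ ℝ^{n×n} have rank at most r, let e ∈ ℝ^m, and let y = Σ_{k=1}^s 𝒜_k(X_k) + e. Let X_{k,l} be rank-r matrices, and define r_l = y − Σ_k 𝒜_k(X_{k,l}), G_{k,l} = 𝒜_k^*(r_l), α_{k,l} = ‖P_{T_{k,l}}(G_{k,l})‖_F² / ‖𝒜_k(P_{T_{k,l}}(G_{k,l}))‖² (with P_{T_{k,l}}(G_{k,l}) ≠ 0), and let X_{k,l+1} be a best rank-r approximation of X_{k,l} + α_{k,l} G_{k,l}. Then √(Σ_{k=1}^s ‖X_{k,l+1} − X_k‖_F²) ≤ (4δ₃ᵣ/(1−δ₃ᵣ))·√(Σ_{k=1}^s ‖X_{k,l} − X_k‖_F²) + (2√(1+δ₃ᵣ)/(1−δ₂ᵣ))·‖e‖. -/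

import Mathlib

open Matrix MeasureTheory ProbabilityTheory Finset

noncomputable section

/-- Frobenius inner product on square real matrices: `⟨X,Y⟩ = trace (Xᵀ Y)`. -/
def finner {n : ℕ} (X Y : Matrix (Fin n) (Fin n) ℝ) : ℝ := (Xᵀ * Y).trace

/-- Frobenius norm. -/
def fnorm {n : ℕ} (X : Matrix (Fin n) (Fin n) ℝ) : ℝ := Real.sqrt (finner X X)

/-- Euclidean norm on `ℝ^m`. -/
def enorm2 {m : ℕ} (v : Fin m → ℝ) : ℝ := Real.sqrt (∑ p, (v p) ^ 2)

/-- The linear operator `𝒜` associated with measurement matrices `A_p`: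
`(𝒜 Z)_p = (1/√m) ⟨A_p, Z⟩`. -/
def opA {n m : ℕ} (A : Fin m → Matrix (Fin n) (Fin n) ℝ)
    (Z : Matrix (Fin n) (Fin n) ℝ) : Fin m → ℝ :=
  fun p => (1 / Real.sqrt m) * finner (A p) Z

/-- The adjoint operator `𝒜^* v = (1/√m) Σ_p v_p A_p`. -/
def adjA {n m : ℕ} (A : Fin m → Matrix (Fin n) (Fin n) ℝ)
    (v : Fin m → ℝ) : Matrix (Fin n) (Fin n) ℝ :=
  (1 / Real.sqrt m) • ∑ p, v p • A p

/-- Amalgam restricted isometry property at rank `r` with parameter `δ`. -/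
def ARIP {n m s : ℕ} (𝒜 : Fin s → Matrix (Fin n) (Fin n) ℝ → (Fin m → ℝ))
    (r : ℕ) (δ : ℝ) : Prop :=
  ∀ Z : Fin s → Matrix (Fin n) (Fin n) ℝ, (∀ k, (Z k).rank ≤ r) →
    (1 - δ) * ∑ k, fnorm (Z k) ^ 2 ≤ enorm2 (∑ k, 𝒜 k (Z k)) ^ 2 ∧
    enorm2 (∑ k, 𝒜 k (Z k)) ^ 2 ≤ (1 + δ) * ∑ k, fnorm (Z k) ^ 2

/-- Orthogonal projection onto the tangent space determined by the SVD factors `U`, `V`: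
`P_T(G) = UUᵀG + GVVᵀ − UUᵀGVVᵀ`. -/
def Pt {n r : ℕ} (U V : Matrix (Fin n) (Fin r) ℝ)
    (G : Matrix (Fin n) (Fin n) ℝ) : Matrix (Fin n) (Fin n) ℝ :=
  U * Uᵀ * G + G * (V * Vᵀ) - U * Uᵀ * G * (V * Vᵀ)

/-- `X'` is a best rank-`r` approximation of `W` in Frobenius norm. -/
def IsBestRankApprox {n : ℕ} (r : ℕ) (W X' : Matrix (Fin n) (Fin n) ℝ) : Prop :=
  X'.rank ≤ r ∧ ∀ Z : Matrix (Fin n) (Fin n) ℝ, Z.rank ≤ r → fnorm (X' - W) ≤ fnorm (Z - W)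

lemma finner_sum {n : ℕ} (X Y : Matrix (Fin n) (Fin n) ℝ) :
    finner X Y = ∑ i, ∑ j, X i j * Y i j := by
  unfold finner
  simp only [Matrix.trace, Matrix.diag, Matrix.mul_apply, Matrix.transpose_apply]
  exact Finset.sum_comm

lemma finner_comm' {n : ℕ} (X Y : Matrix (Fin n) (Fin n) ℝ) : finner X Y = finner Y X := by
  simp only [finner_sum, mul_comm]

lemma finner_add_r {n : ℕ} (X Y Z : Matrix (Fin n) (Fin n) ℝ) :
    finner X (Y + Z) = finner X Y + finner X Z := by
  simp [finner, Matrix.mul_add]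

lemma finner_smul_r {n : ℕ} (a : ℝ) (X Y : Matrix (Fin n) (Fin n) ℝ) :
    finner X (a • Y) = a * finner X Y := by
  simp [finner]

lemma finner_add_l {n : ℕ} (X Y Z : Matrix (Fin n) (Fin n) ℝ) :
    finner (X + Y) Z = finner X Z + finner Y Z := by
  simp [finner, Matrix.add_mul]

lemma finner_smul_l {n : ℕ} (a : ℝ) (X Y : Matrix (Fin n) (Fin n) ℝ) :
    finner (a • X) Y = a * finner X Y := by
  simp [finner]

lemma finner_self_nonneg {n : ℕ} (X : Matrix (Fin n) (Fin n) ℝ) : 0 ≤ finner X X := by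
  rw [finner_sum]
  exact Finset.sum_nonneg fun i _ => Finset.sum_nonneg fun j _ => mul_self_nonneg _

lemma finner_self_pos {n : ℕ} (X : Matrix (Fin n) (Fin n) ℝ) (h : X ≠ 0) : 0 < finner X X := by
  refine lt_of_le_of_ne (finner_self_nonneg X) fun h0 => h ?_
  rw [finner_sum] at h0
  have h1 := (Finset.sum_eq_zero_iff_of_nonneg
    (fun i _ => Finset.sum_nonneg fun j _ => mul_self_nonneg _)).1 h0.symm
  ext i j
  have h2 := (Finset.sum_eq_zero_iff_of_nonneg
    (fun j _ => mul_self_nonneg _)).1 (h1 i (Finset.mem_univ _)) j (Finset.mem_univ _)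
  simpa using h2

lemma fnorm_sq {n : ℕ} (X : Matrix (Fin n) (Fin n) ℝ) : fnorm X ^ 2 = finner X X :=
  Real.sq_sqrt (finner_self_nonneg X)

lemma enorm2_sq {m : ℕ} (v : Fin m → ℝ) : enorm2 v ^ 2 = ∑ p, v p * v p := by
  unfold enorm2
  rw [Real.sq_sqrt (Finset.sum_nonneg fun p _ => sq_nonneg _)]
  simp only [sq]

lemma opA_add {n m : ℕ} (A : Fin m → Matrix (Fin n) (Fin n) ℝ) (X Y) :
    opA A (X + Y) = opA A X + opA A Y := by
  ext p; simp [opA, finner_add_r, mul_add]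

lemma opA_smul {n m : ℕ} (A : Fin m → Matrix (Fin n) (Fin n) ℝ) (a : ℝ) (X) :
    opA A (a • X) = a • opA A X := by
  ext p; simp [opA, finner_smul_r]; ring

lemma opA_zero {n m : ℕ} (A : Fin m → Matrix (Fin n) (Fin n) ℝ) :
    opA A 0 = 0 := by
  ext p; simp [opA, finner]

lemma finner_adj {n m : ℕ} (A : Fin m → Matrix (Fin n) (Fin n) ℝ) (D) (v : Fin m → ℝ) :
    finner D (adjA A v) = ∑ p, opA A D p * v p := by
  have h : finner D (∑ p, v p • A p) = ∑ p, v p * finner (A p) D := by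
    simp only [finner, Matrix.mul_sum, Matrix.trace_sum]
    refine Finset.sum_congr rfl fun p _ => ?_
    have := finner_comm' D (A p)
    simp only [finner] at this
    simp [this]
  rw [adjA, finner_smul_r, h, Finset.mul_sum]
  refine Finset.sum_congr rfl fun p _ => ?_
  simp only [opA]; ring

lemma mrank_add_le {n : ℕ} (X Y : Matrix (Fin n) (Fin n) ℝ) :
    (X + Y).rank ≤ X.rank + Y.rank := by
  unfold Matrix.rank
  rw [Matrix.mulVecLin_add]
  refine (Submodule.finrank_mono (LinearMap.range_add_le _ _)).trans ?_
  exact Submodule.finrank_add_le_finrank_add_finrank _ _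

lemma rank_smul_le' {n : ℕ} (a : ℝ) (X : Matrix (Fin n) (Fin n) ℝ) : (a • X).rank ≤ X.rank := by
  have : a • X = (a • (1 : Matrix (Fin n) (Fin n) ℝ)) * X := by simp
  rw [this]; exact Matrix.rank_mul_le_right _ _

lemma rank_Pt {n r : ℕ} (U V : Matrix (Fin n) (Fin r) ℝ) (G : Matrix (Fin n) (Fin n) ℝ) :
    (Pt U V G).rank ≤ 2 * r := by
  have : Pt U V G = U * (Uᵀ * G) + (G * V - U * Uᵀ * G * V) * Vᵀ := by
    simp only [Pt, Matrix.sub_mul, Matrix.mul_assoc, add_sub_assoc]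
  rw [this]
  refine (mrank_add_le _ _).trans ?_
  have h1 := (Matrix.rank_mul_le_left U (Uᵀ * G)).trans (Matrix.rank_le_width U)
  have h2 := (Matrix.rank_mul_le_left (G * V - U * Uᵀ * G * V) Vᵀ).trans (Matrix.rank_le_width _)
  omega

/-- quadratic trick -/
lemma quad_bound (P Q c : ℝ) (hP : 0 ≤ P) (hQ : 0 ≤ Q)
    (h : ∀ t : ℝ, 2 * t * c ≤ t ^ 2 * P + Q) : c ≤ Real.sqrt P * Real.sqrt Q := by
  have hd : discrim P (-(2 * c)) Q ≤ 0 := by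
    apply discrim_le_zero
    intro t
    have := h t
    nlinarith
  rw [discrim] at hd
  rw [← Real.sqrt_mul hP]
  apply Real.le_sqrt_of_sq_le
  nlinarith

lemma sum_cs {n s : ℕ} (u v : Fin s → Matrix (Fin n) (Fin n) ℝ) :
    ∑ k, finner (u k) (v k) ≤
      Real.sqrt (∑ k, finner (u k) (u k)) * Real.sqrt (∑ k, finner (v k) (v k)) := by
  apply quad_bound _ _ _ (Finset.sum_nonneg fun k _ => finner_self_nonneg _)
    (Finset.sum_nonneg fun k _ => finner_self_nonneg _)
  intro t
  rw [Finset.mul_sum, Finset.mul_sum, ← Finset.sum_add_distrib]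
  refine Finset.sum_le_sum fun k _ => ?_
  have := finner_self_nonneg (t • u k + (-1 : ℝ) • v k)
  simp only [finner_add_r, finner_add_l, finner_smul_l, finner_smul_r] at this
  rw [finner_comm' (v k) (u k)] at this
  nlinarith

lemma vec_cs {m : ℕ} (u v : Fin m → ℝ) : ∑ p, u p * v p ≤ enorm2 u * enorm2 v :=
  Real.sum_mul_le_sqrt_mul_sqrt _ u v

/-- polarization -/
lemma arip_polar {n m s R : ℕ} (A : Fin s → Fin m → Matrix (Fin n) (Fin n) ℝ) (δ : ℝ) (hδ : 0 ≤ δ)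
    (h : ARIP (fun k => opA (A k)) R δ) (u v : Fin s → Matrix (Fin n) (Fin n) ℝ)
    (hr : ∀ a b : ℝ, ∀ k, (a • u k + b • v k).rank ≤ R) :
    ∑ k, finner (u k) (v k) - ∑ p, (∑ k, opA (A k) (u k)) p * (∑ k, opA (A k) (v k)) p ≤
      δ * (Real.sqrt (∑ k, finner (u k) (u k)) * Real.sqrt (∑ k, finner (v k) (v k))) := by
  set P := ∑ k, finner (u k) (u k) with hP
  set Q := ∑ k, finner (v k) (v k) with hQ
  set c := ∑ k, finner (u k) (v k) with hc
  set a := ∑ k, opA (A k) (u k) with ha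
  set b := ∑ k, opA (A k) (v k) with hb
  have hP0 : 0 ≤ P := Finset.sum_nonneg fun k _ => finner_self_nonneg _
  have hQ0 : 0 ≤ Q := Finset.sum_nonneg fun k _ => finner_self_nonneg _
  have hE : ∀ x y : ℝ, ∑ k, fnorm (x • u k + y • v k) ^ 2 = x ^ 2 * P + 2 * x * y * c + y ^ 2 * Q := by
    intro x y
    simp only [hP, hQ, hc, Finset.mul_sum, ← Finset.sum_add_distrib]
    refine Finset.sum_congr rfl fun k _ => ?_
    simp only [fnorm_sq, finner_add_r, finner_add_l, finner_smul_l, finner_smul_r]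
    rw [finner_comm' (v k) (u k)]
    ring
  have hF : ∀ x y : ℝ, enorm2 (∑ k, opA (A k) (x • u k + y • v k)) ^ 2 =
      x ^ 2 * (∑ p, a p * a p) + 2 * x * y * (∑ p, a p * b p) + y ^ 2 * ∑ p, b p * b p := by
    intro x y
    have : ∑ k, opA (A k) (x • u k + y • v k) = x • a + y • b := by
      simp only [opA_add, opA_smul, Finset.sum_add_distrib, ← Finset.smul_sum, ha, hb]
    rw [this, enorm2_sq]
    simp only [Finset.mul_sum, ← Finset.sum_add_distrib]
    refine Finset.sum_congr rfl fun p _ => ?_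
    simp only [Pi.add_apply, Pi.smul_apply, smul_eq_mul]
    ring
  have key := quad_bound (δ * P) (δ * Q) (c - ∑ p, a p * b p) (mul_nonneg hδ hP0)
    (mul_nonneg hδ hQ0) (by
      intro t
      have h1 := (h (fun k => t • u k + (1 : ℝ) • v k) (hr t 1)).1
      have h2 := (h (fun k => t • u k + (-1 : ℝ) • v k) (hr t (-1))).2
      rw [hE, hF] at h1 h2
      nlinarith)
  refine key.trans (le_of_eq ?_)
  rw [Real.sqrt_mul hδ, Real.sqrt_mul hδ]
  have := Real.mul_self_sqrt hδ
  linear_combination (√P * √Q) * this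

lemma arip_single {n m s R : ℕ} (A : Fin s → Fin m → Matrix (Fin n) (Fin n) ℝ) (δ : ℝ)
    (h : ARIP (fun k => opA (A k)) R δ) (k : Fin s) (Z : Matrix (Fin n) (Fin n) ℝ)
    (hZ : Z.rank ≤ R) :
    (1 - δ) * fnorm Z ^ 2 ≤ enorm2 (opA (A k) Z) ^ 2 ∧
    enorm2 (opA (A k) Z) ^ 2 ≤ (1 + δ) * fnorm Z ^ 2 := by
  have := h (Pi.single k Z) (by
    intro j
    by_cases hj : j = k
    · subst hj; simpa using hZ
    · simp [hj])
  have e1 : ∑ j, fnorm ((Pi.single k Z : Fin s → Matrix (Fin n) (Fin n) ℝ) j) ^ 2 = fnorm Z ^ 2 := by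
    rw [Finset.sum_eq_single k]
    · simp
    · intro j _ hj
      simp [hj, fnorm_sq, finner]
    · simp
  have e2 : ∑ j, opA (A j) ((Pi.single k Z : Fin s → Matrix (Fin n) (Fin n) ℝ) j) = opA (A k) Z := by
    rw [Finset.sum_eq_single k]
    · simp
    · intro j _ hj
      simp [hj, opA_zero]
    · simp
  simp only [e1, e2] at this
  exact this

lemma best_step {n r : ℕ} (W Xn X : Matrix (Fin n) (Fin n) ℝ) (hX : X.rank ≤ r)
    (h : IsBestRankApprox r W Xn) :
    finner (Xn - X) (Xn - X) ≤ 2 * finner (Xn - X) (W - X) := by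
  have h1 := h.2 X hX
  have h2 : fnorm (Xn - W) ^ 2 ≤ fnorm (X - W) ^ 2 :=
    pow_le_pow_left₀ (Real.sqrt_nonneg _) h1 2
  have e1 : Xn - W = (Xn - X) + (-1 : ℝ) • (W - X) := by simp
  have e2 : X - W = (-1 : ℝ) • (W - X) := by simp
  rw [e1, e2, fnorm_sq, fnorm_sq] at h2
  simp only [finner_add_r, finner_add_l, finner_smul_l, finner_smul_r] at h2
  rw [finner_comm' (W - X) (Xn - X)] at h2
  linarith

lemma scale_bound {n s : ℕ} (c : ℝ) (hc : 0 ≤ c) (β : Fin s → ℝ) (hβ : ∀ k, |β k| ≤ c)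
    (D : Fin s → Matrix (Fin n) (Fin n) ℝ) :
    Real.sqrt (∑ k, finner (β k • D k) (β k • D k)) ≤ c * Real.sqrt (∑ k, finner (D k) (D k)) := by
  rw [← Real.sqrt_sq hc, ← Real.sqrt_mul (sq_nonneg c)]
  apply Real.sqrt_le_sqrt
  rw [Finset.mul_sum]
  refine Finset.sum_le_sum fun k _ => ?_
  rw [finner_smul_l, finner_smul_r, ← mul_assoc]
  refine mul_le_mul_of_nonneg_right ?_ (finner_self_nonneg _)
  have := sq_le_sq' (abs_le.1 (hβ k)).1 (abs_le.1 (hβ k)).2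
  linarith [sq (β k)]

/-- One step of IHT in the presence of additive noise. -/
theorem iht_one_step_noise
    {n m r s : ℕ}
    (A : Fin s → Fin m → Matrix (Fin n) (Fin n) ℝ)
    (δ₂ δ₃ : ℝ) (hδ₂₃ : δ₂ ≤ δ₃) (hδ₃ : δ₃ < 1)
    (hARIP2 : ARIP (fun k => opA (A k)) (2 * r) δ₂)
    (hARIP3 : ARIP (fun k => opA (A k)) (3 * r) δ₃)
    (X Xl Xnext : Fin s → Matrix (Fin n) (Fin n) ℝ)
    (hX : ∀ k, (X k).rank ≤ r)
    (e : Fin m → ℝ)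
    (y : Fin m → ℝ) (hy : y = (∑ k, opA (A k) (X k)) + e)
    (U V : Fin s → Matrix (Fin n) (Fin r) ℝ)
    (S : Fin s → Matrix (Fin r) (Fin r) ℝ)
    (hU : ∀ k, (U k)ᵀ * U k = 1) (hV : ∀ k, (V k)ᵀ * V k = 1)
    (hSdiag : ∀ k i j, i ≠ j → S k i j = 0) (hSpos : ∀ k i, 0 < S k i i)
    (hXl : ∀ k, Xl k = U k * S k * (V k)ᵀ)
    (G : Fin s → Matrix (Fin n) (Fin n) ℝ)
    (hG : ∀ k, G k = adjA (A k) (y - ∑ j, opA (A j) (Xl j)))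
    (hPt : ∀ k, Pt (U k) (V k) (G k) ≠ 0)
    (α : Fin s → ℝ)
    (hα : ∀ k, α k = fnorm (Pt (U k) (V k) (G k)) ^ 2 /
        enorm2 (opA (A k) (Pt (U k) (V k) (G k))) ^ 2)
    (hNext : ∀ k, IsBestRankApprox r (Xl k + α k • G k) (Xnext k)) :
    Real.sqrt (∑ k, fnorm (Xnext k - X k) ^ 2) ≤
      (4 * δ₃ / (1 - δ₃)) * Real.sqrt (∑ k, fnorm (Xl k - X k) ^ 2) +
      (2 * Real.sqrt (1 + δ₃) / (1 - δ₂)) * enorm2 e := by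
  have hδ₂ : δ₂ < 1 := lt_of_le_of_lt hδ₂₃ hδ₃
  simp only [fnorm_sq]
  rcases Nat.eq_zero_or_pos s with hs | hs
  · subst hs
    simp only [Finset.univ_eq_empty, Finset.sum_empty, Real.sqrt_zero, mul_zero, zero_add]
    exact mul_nonneg (div_nonneg (by positivity) (by linarith)) (Real.sqrt_nonneg _)
  have hs1 : ∀ k, 0 < fnorm (Pt (U k) (V k) (G k)) ^ 2 := fun k => by
    rw [fnorm_sq]; exact finner_self_pos _ (hPt k)
  have hsing := fun k => arip_single A δ₂ hARIP2 k (Pt (U k) (V k) (G k)) (rank_Pt _ _ _)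
  have hδ₂0 : 0 ≤ δ₂ := by
    have h1 := hsing ⟨0, hs⟩
    have h2 := hs1 ⟨0, hs⟩
    by_contra hneg
    push Not at hneg
    nlinarith [h1.1.trans h1.2]
  have hδ₃0 : 0 ≤ δ₃ := hδ₂0.trans hδ₂₃
  have h1δ : 0 < 1 - δ₂ := by linarith
  have hN : ∀ k, 0 < enorm2 (opA (A k) (Pt (U k) (V k) (G k))) ^ 2 := fun k =>
    lt_of_lt_of_le (mul_pos h1δ (hs1 k)) (hsing k).1
  have hαpos : ∀ k, 0 ≤ α k := fun k => by
    rw [hα k]; exact div_nonneg (hs1 k).le (hN k).le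
  have hαle : ∀ k, (1 - δ₂) * α k ≤ 1 := fun k => by
    rw [hα k, ← mul_div_assoc, div_le_one (hN k)]; exact (hsing k).1
  have hαge : ∀ k, 1 ≤ (1 + δ₂) * α k := fun k => by
    rw [hα k, ← mul_div_assoc, one_le_div (hN k)]; exact (hsing k).2
  have hα1 : ∀ k, |α k| ≤ 1 / (1 - δ₂) := fun k => by
    rw [abs_of_nonneg (hαpos k), le_div_iff₀ h1δ]; linarith [hαle k]
  have hα2 : ∀ k, |1 - α k| ≤ δ₂ / (1 - δ₂) := fun k => by
    rw [abs_le, ← neg_div, div_le_iff₀ h1δ, le_div_iff₀ h1δ]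
    have := hαle k
    have := hαge k
    have h3 : 1 - δ₂ ≤ α k := by
      by_contra hc
      push Not at hc
      nlinarith [mul_nonneg hδ₂0 hδ₂0]
    constructor <;> nlinarith [mul_nonneg hδ₂0 hδ₂0]
  set D : Fin s → Matrix (Fin n) (Fin n) ℝ := fun k => Xnext k - X k with hD
  set E : Fin s → Matrix (Fin n) (Fin n) ℝ := fun k => Xl k - X k with hE
  set d := Real.sqrt (∑ k, finner (D k) (D k)) with hd
  set ε := Real.sqrt (∑ k, finner (E k) (E k)) with hε
  change d ≤ 4 * δ₃ / (1 - δ₃) * ε + _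
  have hd0 : 0 ≤ d := Real.sqrt_nonneg _
  have hε0 : 0 ≤ ε := Real.sqrt_nonneg _
  have hres : y - ∑ j, opA (A j) (Xl j) = e - ∑ j, opA (A j) (E j) := by
    have : ∀ j, opA (A j) (Xl j) = opA (A j) (E j) + opA (A j) (X j) := fun j => by
      rw [← opA_add]; simp [hE]
    simp only [hy, this, Finset.sum_add_distrib]
    abel
  have hXlr : ∀ k, (Xl k).rank ≤ r := fun k => by
    rw [hXl k, Matrix.mul_assoc]
    exact (Matrix.rank_mul_le_left _ _).trans (Matrix.rank_le_width _)
  have hrank : ∀ (a b : ℝ) (k : Fin s), (a • (α k • D k) + b • E k).rank ≤ 3 * r := by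
    intro a b k
    have e1 : a • (α k • D k) + b • E k =
        (a * α k) • Xnext k + (b • Xl k + (-(a * α k) - b) • X k) := by
      simp only [hD, hE, smul_smul]; module
    rw [e1]
    have t1 := (rank_smul_le' (a * α k) (Xnext k)).trans (hNext k).1
    have t2 := (rank_smul_le' b (Xl k)).trans (hXlr k)
    have t3 := (rank_smul_le' (-(a * α k) - b) (X k)).trans (hX k)
    have t4 := mrank_add_le ((a * α k) • Xnext k) (b • Xl k + (-(a * α k) - b) • X k)
    have t5 := mrank_add_le (b • Xl k) ((-(a * α k) - b) • X k)
    omega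
  have hstep : ∀ k, finner (D k) (D k) ≤
      2 * (finner ((1 - α k) • D k) (E k) + (finner (α k • D k) (E k) +
        ∑ p, opA (A k) (α k • D k) p * (e - ∑ j, opA (A j) (E j)) p)) := by
    intro k
    have h1 := best_step _ _ _ (hX k) (hNext k)
    have e1 : Xl k + α k • G k - X k = E k + α k • G k := by simp only [hE]; abel
    rw [e1, finner_add_r, finner_smul_r, hG k, finner_adj, hres] at h1
    refine h1.trans (le_of_eq ?_)
    rw [finner_smul_l, finner_smul_l, opA_smul, Finset.mul_sum]
    simp only [Pi.smul_apply, smul_eq_mul, mul_assoc]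
    change 2 * (finner (D k) (E k) + _) = _
    ring
  set a := ∑ k, opA (A k) (α k • D k) with ha
  set b := ∑ k, opA (A k) (E k) with hb
  have hsum : d ^ 2 ≤ 2 * (∑ k, finner ((1 - α k) • D k) (E k) +
      ((∑ k, finner (α k • D k) (E k) - ∑ p, a p * b p) + ∑ p, a p * e p)) := by
    rw [hd, Real.sq_sqrt (Finset.sum_nonneg fun k _ => finner_self_nonneg _)]
    refine (Finset.sum_le_sum fun k _ => hstep k).trans (le_of_eq ?_)
    rw [← Finset.mul_sum, Finset.sum_add_distrib, Finset.sum_add_distrib, Finset.sum_comm]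
    have : ∑ p, ∑ k, opA (A k) (α k • D k) p * (e - b) p = ∑ p, a p * e p - ∑ p, a p * b p := by
      rw [← Finset.sum_sub_distrib]
      refine Finset.sum_congr rfl fun p _ => ?_
      rw [← Finset.sum_mul, ha, Finset.sum_apply, Pi.sub_apply]
      ring
    rw [this]; ring
  have hc1 : 0 ≤ 1 / (1 - δ₂) := by positivity
  have hc2 : 0 ≤ δ₂ / (1 - δ₂) := by positivity
  have hαD := scale_bound _ hc1 α hα1 D
  have b1 : ∑ k, finner ((1 - α k) • D k) (E k) ≤ δ₂ / (1 - δ₂) * d * ε :=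
    (sum_cs _ _).trans (mul_le_mul_of_nonneg_right (scale_bound _ hc2 _ hα2 D) hε0)
  have b2 : ∑ k, finner (α k • D k) (E k) - ∑ p, a p * b p ≤ δ₃ * (1 / (1 - δ₂) * d * ε) :=
    (arip_polar A δ₃ hδ₃0 hARIP3 (fun k => α k • D k) E hrank).trans
      (mul_le_mul_of_nonneg_left (mul_le_mul_of_nonneg_right hαD hε0) hδ₃0)
  have hen : 0 ≤ enorm2 e := Real.sqrt_nonneg _
  have b3 : ∑ p, a p * e p ≤ Real.sqrt (1 + δ₃) * (1 / (1 - δ₂) * d) * enorm2 e := by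
    refine (vec_cs _ _).trans (mul_le_mul_of_nonneg_right ?_ hen)
    have h1 := (hARIP3 (fun k => α k • D k) (fun k => by simpa using hrank 1 0 k)).2
    simp only [fnorm_sq] at h1
    have h2 := Real.sqrt_le_sqrt h1
    have h3 : 0 ≤ enorm2 a := Real.sqrt_nonneg _
    rw [Real.sqrt_mul (by linarith), Real.sqrt_sq h3] at h2
    exact h2.trans (mul_le_mul_of_nonneg_left hαD (Real.sqrt_nonneg _))
  have hcoef : 2 * (δ₂ / (1 - δ₂) + δ₃ * (1 / (1 - δ₂))) ≤ 4 * δ₃ / (1 - δ₃) := by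
    rw [mul_one_div, ← add_div, ← mul_div_assoc]
    apply div_le_div₀ <;> linarith
  have hfin : d * d ≤ d * (4 * δ₃ / (1 - δ₃) * ε + 2 * Real.sqrt (1 + δ₃) / (1 - δ₂) * enorm2 e) := by
    have h1 := mul_le_mul_of_nonneg_right hcoef (mul_nonneg hd0 hε0)
    have h2 : 2 * Real.sqrt (1 + δ₃) / (1 - δ₂) = 2 * (Real.sqrt (1 + δ₃) * (1 / (1 - δ₂))) := by ring
    rw [h2]
    nlinarith
  rcases hd0.eq_or_lt with h0 | h0
  · rw [← h0]
    have : 0 ≤ 4 * δ₃ / (1 - δ₃) := div_nonneg (by linarith) (by linarith)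
    positivity
  · exact le_of_mul_le_mul_left hfin h0
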